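/- In the setup Vᵢ = (2X + (2i−1)Δ, (X+(i−1)Δ)(X+iΔ)/s), the slope of the segment VᵢVⱼ equals (2X + (i+j−1)Δ)/(2s). Hence if j − i > 0 is odd, the segments VᵢVⱼ, V_{i+1}V_{j−1}, ..., V_{(j+i+1)/2}V_{(j+i−1)/2} are all parallel. -/

import Mathlib

/-- With `Vᵢ = (2X+(2i-1)Δ, (X+(i-1)Δ)(X+iΔ)/s)`, the slope of `VᵢVⱼ` equals
`(2X+(i+j-1)Δ)/(2s)`; hence if `j - i > 0` is odd, the segments `VᵢVⱼ`, `Vᵢ₊₁Vⱼ₋₁`, ...,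
are all parallel (have equal slopes). -/
theorem stmt_10 (s X Δ : ℝ) (hs : s ≠ 0) (hΔ : 0 < Δ) (V : ℕ → ℝ × ℝ)
    (hV : V = fun i : ℕ => (2 * X + (2 * (i : ℝ) - 1) * Δ,
      (X + ((i : ℝ) - 1) * Δ) * (X + (i : ℝ) * Δ) / s)) :
    (∀ i j : ℕ, i < j →
      ((V j).2 - (V i).2) / ((V j).1 - (V i).1) = (2 * X + ((i : ℝ) + (j : ℝ) - 1) * Δ) / (2 * s)) ∧
    (∀ i j t : ℕ, i < j → Odd (j - i) → i + t < j - t →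
      ((V (j - t)).2 - (V (i + t)).2) / ((V (j - t)).1 - (V (i + t)).1) =
        ((V j).2 - (V i).2) / ((V j).1 - (V i).1)) := by
  have key : ∀ i j : ℕ, i < j →
      ((V j).2 - (V i).2) / ((V j).1 - (V i).1) =
        (2 * X + ((i : ℝ) + (j : ℝ) - 1) * Δ) / (2 * s) := by
    intro i j hij
    have h : (i : ℝ) < j := by exact_mod_cast hij
    have hd : (2 * X + (2 * (j : ℝ) - 1) * Δ) - (2 * X + (2 * (i : ℝ) - 1) * Δ) ≠ 0 := by
      have : 0 < ((j : ℝ) - i) * Δ := mul_pos (by linarith) hΔ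
      intro h0
      linarith
    subst hV
    show ((X + ((j : ℝ) - 1) * Δ) * (X + (j : ℝ) * Δ) / s -
      (X + ((i : ℝ) - 1) * Δ) * (X + (i : ℝ) * Δ) / s) / _ = _
    rw [← sub_div, div_div, div_eq_div_iff (mul_ne_zero hs hd) (by simpa using hs)]
    ring
  refine ⟨key, ?_⟩
  intro i j t hij _ ht
  rw [key _ _ ht, key _ _ hij, Nat.cast_sub (by omega : t ≤ j)]
  push_cast
  ring
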